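/- Let α be a globalizable partial action of a finite group G on a unital C*-algebra A, and let (B, β) be its globalization. Then dim_Rok(α) = dim_Rok(β) and dim_Rok^c(α) = dim_Rok^c(β). -/

import Mathlib

/-- A partial action of a (discrete) group `G` on a C*-algebra `A`: a family of closed
two-sided (star-closed) ideals `dom g ⊆ A` and *-isomorphisms
`act g : dom g⁻¹ → dom g` (encoded as total maps, with all axioms stated on the domains),
such that `dom 1 = A`, `act 1 = id`, `act g` maps `dom g⁻¹ ∩ dom h` into `dom g ∩ dom (g*h)`,
and `act (g*h)` extends `act g ∘ act h`. -/
structure CStarPartialAction (G : Type*) [Group G] (A : Type*) [NonUnitalCStarAlgebra A] where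
  dom : G → Set A
  act : G → A → A
  dom_isClosed : ∀ g, IsClosed (dom g)
  zero_mem : ∀ g, (0 : A) ∈ dom g
  add_mem : ∀ g, ∀ x ∈ dom g, ∀ y ∈ dom g, x + y ∈ dom g
  smul_mem : ∀ g (c : ℂ), ∀ x ∈ dom g, c • x ∈ dom g
  mul_mem_left : ∀ g (a : A), ∀ x ∈ dom g, a * x ∈ dom g
  mul_mem_right : ∀ g (a : A), ∀ x ∈ dom g, x * a ∈ dom g
  star_mem : ∀ g, ∀ x ∈ dom g, star x ∈ dom g
  dom_one : dom 1 = Set.univ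
  act_one : ∀ x, act 1 x = x
  act_mem : ∀ g, ∀ x ∈ dom g⁻¹, act g x ∈ dom g
  act_add : ∀ g, ∀ x ∈ dom g⁻¹, ∀ y ∈ dom g⁻¹, act g (x + y) = act g x + act g y
  act_smul : ∀ g (c : ℂ), ∀ x ∈ dom g⁻¹, act g (c • x) = c • act g x
  act_mul : ∀ g, ∀ x ∈ dom g⁻¹, ∀ y ∈ dom g⁻¹, act g (x * y) = act g x * act g y
  act_star : ∀ g, ∀ x ∈ dom g⁻¹, act g (star x) = star (act g x)
  act_inv_act : ∀ g, ∀ x ∈ dom g⁻¹, act g⁻¹ (act g x) = x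
  act_surjOn : ∀ g, ∀ y ∈ dom g, ∃ x ∈ dom g⁻¹, act g x = y
  act_inter_mem : ∀ g h, ∀ x ∈ dom g⁻¹ ∩ dom h, act g x ∈ dom g ∩ dom (g * h)
  act_comp : ∀ g h, ∀ x ∈ dom h⁻¹ ∩ dom (g * h)⁻¹, act (g * h) x = act g (act h x)

/-- A positive contraction in a C*-algebra. -/
def IsPosContraction {A : Type*} [NonUnitalCStarAlgebra A] (f : A) : Prop :=
  (∃ b, f = star b * b) ∧ ‖f‖ ≤ 1

variable {G : Type*} [Group G] [Fintype G] {A : Type*} [NonUnitalCStarAlgebra A]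

/-- Conditions (1)–(4) of the definition of Rokhlin dimension, for the tolerance `ε` and
finite set `F`. -/
def RokhlinTowers (α : CStarPartialAction G A) (d : ℕ) (F : Finset A) (ε : ℝ)
    (f : G → Fin (d + 1) → A) : Prop :=
  (∀ g j, f g j ∈ α.dom g ∧ IsPosContraction (f g j)) ∧
  (∀ g h j, ∀ a ∈ F, ∀ x ∈ F, x ∈ α.dom g⁻¹ →
    ‖(α.act g (f h j * x) - f (g * h) j * α.act g x) * a‖ < ε) ∧
  (∀ j, ∀ g h : G, g ≠ h → ∀ a ∈ F, ‖f g j * f h j * a‖ < ε) ∧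
  (∀ a ∈ F, ‖(∑ j : Fin (d + 1), ∑ g : G, f g j) * a - a‖ < ε) ∧
  (∀ g j, ∀ a ∈ F, ∀ b ∈ F, ‖(f g j * b - b * f g j) * a‖ < ε)

/-- Condition (5): approximately commuting towers. -/
def CommutingTowers (d : ℕ) (F : Finset A) (ε : ℝ) (f : G → Fin (d + 1) → A) : Prop :=
  ∀ g h : G, ∀ j k : Fin (d + 1), ∀ a ∈ F, ‖(f g j * f h k - f h k * f g j) * a‖ < ε

/-- `α` has Rokhlin dimension at most `d`. -/
def HasRokhlinDimLE (α : CStarPartialAction G A) (d : ℕ) : Prop :=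
  ∀ ε > (0 : ℝ), ∀ F : Finset A, ∃ f : G → Fin (d + 1) → A, RokhlinTowers α d F ε f

/-- `α` has Rokhlin dimension with commuting towers at most `d`. -/
def HasRokhlinDimCLE (α : CStarPartialAction G A) (d : ℕ) : Prop :=
  ∀ ε > (0 : ℝ), ∀ F : Finset A, ∃ f : G → Fin (d + 1) → A,
    RokhlinTowers α d F ε f ∧ CommutingTowers d F ε f

/-- The Rokhlin dimension of `α`, as an extended natural number. -/
noncomputable def rokhlinDim (α : CStarPartialAction G A) : ℕ∞ :=
  sInf {n : ℕ∞ | ∃ d : ℕ, n = d ∧ HasRokhlinDimLE α d}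

/-- The Rokhlin dimension with commuting towers of `α`. -/
noncomputable def rokhlinDimC (α : CStarPartialAction G A) : ℕ∞ :=
  sInf {n : ℕ∞ | ∃ d : ℕ, n = d ∧ HasRokhlinDimCLE α d}

section CentralProjections

variable {B : Type*} [NonUnitalCStarAlgebra B]

/-- A self-adjoint idempotent commuting with every element. -/
structure IsCentralProjection (p : B) : Prop where
  idem : p * p = p
  star_eq : star p = p
  comm : ∀ x, p * x = x * p

namespace IsCentralProjection

theorem zero : IsCentralProjection (0 : B) := ⟨by simp, by simp, by simp⟩

theorem norm_le_one {p : B} (hp : IsCentralProjection p) : ‖p‖ ≤ 1 :=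
  IsStarProjection.norm_le p ⟨hp.idem, hp.star_eq⟩

theorem norm_mul_le {p : B} (hp : IsCentralProjection p) (x : B) : ‖x * p‖ ≤ ‖x‖ :=
  (_root_.norm_mul_le _ _).trans (mul_le_of_le_one_right (norm_nonneg _) hp.norm_le_one)

theorem mul_right_comm {p : B} (hp : IsCentralProjection p) (x y : B) :
    x * p * y = x * y * p := by
  rw [mul_assoc, hp.comm, mul_assoc]

theorem mul {p q : B} (hp : IsCentralProjection p) (hq : IsCentralProjection q) :
    IsCentralProjection (p * q) where
  idem := by rw [← mul_assoc, mul_assoc p, ← hp.comm, ← mul_assoc, hp.idem, mul_assoc, hq.idem]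
  star_eq := by rw [star_mul, hp.star_eq, hq.star_eq, hp.comm]
  comm x := by rw [mul_assoc, hq.comm, ← mul_assoc, hp.comm, mul_assoc]

theorem sub_mul {p q : B} (hp : IsCentralProjection p) (hq : IsCentralProjection q) :
    IsCentralProjection (p - q * p) where
  idem := by
    have h : q * p * (q * p) = q * p := (hq.mul hp).idem
    have h1 : p * (q * p) = q * p := by rw [hp.comm, mul_assoc, hp.idem]
    have h2 : q * p * p = q * p := by rw [mul_assoc, hp.idem]
    simp [mul_sub, _root_.sub_mul, h, h1, h2, hp.idem]
  star_eq := by rw [star_sub, (hq.mul hp).star_eq, hp.star_eq]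
  comm x := by rw [mul_sub, _root_.sub_mul, (hq.mul hp).comm, hp.comm]

theorem add {p q : B} (hp : IsCentralProjection p) (hq : IsCentralProjection q)
    (h : p * q = 0) : IsCentralProjection (p + q) where
  idem := by simp [mul_add, add_mul, h, (hp.comm q).symm.trans h, hp.idem, hq.idem]
  star_eq := by rw [star_add, hp.star_eq, hq.star_eq]
  comm x := by rw [mul_add, add_mul, hp.comm, hq.comm]

theorem map {C : Type*} [NonUnitalCStarAlgebra C] {p : B} (hp : IsCentralProjection p)
    (φ : B →⋆ₙₐ[ℂ] C) (hφ : Function.Surjective φ) : IsCentralProjection (φ p) where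
  idem := by rw [← map_mul, hp.idem]
  star_eq := by rw [← map_star, hp.star_eq]
  comm x := by
    obtain ⟨y, rfl⟩ := hφ x
    rw [← map_mul, hp.comm, map_mul]

end IsCentralProjection

/-- Finitely many central projections can be made orthogonal without changing their supremum. -/
theorem exists_orthogonal_centralProjections {I : Type*} [DecidableEq I] (p : I → B)
    (hp : ∀ i, IsCentralProjection (p i)) (s : Finset I) :
    ∃ q : I → B, (∀ i, IsCentralProjection (q i)) ∧ (∀ i j, i ≠ j → q i * q j = 0) ∧
      (∀ i, q i * p i = q i) ∧ (∀ i ∉ s, q i = 0) ∧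
      IsCentralProjection (∑ i ∈ s, q i) ∧ ∀ i ∈ s, (∑ j ∈ s, q j) * p i = p i := by
  induction s using Finset.induction_on with
  | empty => exact ⟨0, fun _ => .zero, by simp, by simp, by simp, by simpa using .zero, by simp⟩
  | insert a s ha ih =>
    obtain ⟨q, hq, horth, hle, hzero, hQ, hsum⟩ := ih
    set Q := ∑ i ∈ s, q i with hQdef
    have hqQ : ∀ i, q i * Q = q i := by
      intro i
      rw [hQdef, Finset.mul_sum]
      by_cases hi : i ∈ s
      · rw [Finset.sum_eq_single_of_mem i hi (fun j _ hj => horth i j hj.symm), (hq i).idem]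
      · simp [hzero i hi]
    have hr : IsCentralProjection (p a - Q * p a) := (hp a).sub_mul hQ
    have hqr : ∀ i, q i * (p a - Q * p a) = 0 := by
      intro i
      rw [mul_sub, ← mul_assoc, hqQ, sub_self]
    have hne : ∀ i ∈ s, Function.update q a (p a - Q * p a) i = q i := fun i hi =>
      Function.update_of_ne (ne_of_mem_of_not_mem hi ha) _ _
    have hS : ∑ i ∈ insert a s, Function.update q a (p a - Q * p a) i
        = (p a - Q * p a) + Q := by
      rw [Finset.sum_insert ha, Function.update_self, Finset.sum_congr rfl hne]
    have hrQ : (p a - Q * p a) * Q = 0 := by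
      rw [sub_mul, mul_assoc, (hp a).comm, ← mul_assoc, hQ.idem, sub_self]
    refine ⟨Function.update q a (p a - Q * p a), ?_, ?_, ?_, ?_, ?_, ?_⟩
    · intro i
      by_cases hi : i = a
      · subst hi; simpa using hr
      · simpa [hi] using hq i
    · intro i j hij
      by_cases hi : i = a
      · subst hi
        rw [Function.update_self, Function.update_of_ne hij.symm, hr.comm, hqr]
      · rw [Function.update_of_ne hi]
        by_cases hj : j = a
        · subst hj
          rw [Function.update_self, hqr]
        · rw [Function.update_of_ne hj, horth i j hij]
    · intro i
      by_cases hi : i = a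
      · subst hi
        rw [Function.update_self, sub_mul, mul_assoc, (hp i).idem]
      · rw [Function.update_of_ne hi, hle]
    · intro i hi
      rw [Finset.mem_insert, not_or] at hi
      rw [Function.update_of_ne hi.1, hzero i hi.2]
    · rw [hS]
      exact hr.add hQ hrQ
    · intro i hi
      rw [hS, add_mul]
      rcases Finset.mem_insert.1 hi with rfl | hi
      · rw [sub_mul, mul_assoc, (hp i).idem, sub_add_cancel]
      · rw [hsum i hi, add_eq_right, sub_mul, (hp a).mul_right_comm, hsum i hi, (hp a).comm,
          sub_self]

/-- If `t • ∑ i, f i` is a contraction with all `f i` positive, then compressing the summands by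
central projections gives a positive contraction. -/
theorem isPosContraction_smul_sum {I : Type*} [Fintype I] (f r : I → B)
    (hf : ∀ i, ∃ b, f i = star b * b) (hr : ∀ i, IsCentralProjection (r i))
    {t : ℝ} (ht : 0 ≤ t)
    (hnorm : t * ‖∑ i, f i‖ ≤ 1) :
    IsPosContraction (t • ∑ i, f i * r i) := by
  let _ := CStarAlgebra.spectralOrder B
  have _ := CStarAlgebra.spectralOrderedRing B
  have hpos : ∀ i, 0 ≤ f i * r i := by
    intro i
    obtain ⟨b, hb⟩ := hf i
    have : f i * r i = star (b * r i) * (b * r i) := by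
      rw [star_mul, (hr i).star_eq, (hr i).comm, hb, mul_assoc, mul_assoc,
        ← mul_assoc (r i), (hr i).comm b, mul_assoc b, (hr i).idem]
    rw [this]
    exact star_mul_self_nonneg _
  have hle : ∀ i, f i * r i ≤ f i := by
    intro i
    obtain ⟨b, hb⟩ := hf i
    have h1 : r i * b * r i = b * r i := by
      rw [(hr i).comm b, mul_assoc, (hr i).idem]
    have : f i - f i * r i = star (b - b * r i) * (b - b * r i) := by
      rw [star_sub, star_mul, (hr i).star_eq, (hr i).comm, hb]
      simp only [sub_mul, mul_sub, mul_assoc]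
      rw [← mul_assoc (r i) b (r i), h1, (hr i).comm b, sub_self, sub_zero]
    rw [← sub_nonneg, this]
    exact star_mul_self_nonneg _
  have hX : 0 ≤ ∑ i, f i * r i := Finset.sum_nonneg fun i _ => hpos i
  constructor
  · obtain ⟨c, hc⟩ := CStarAlgebra.nonneg_iff_eq_star_mul_self.1 hX
    refine ⟨Real.sqrt t • c, ?_⟩
    rw [hc, star_smul, smul_mul_smul_comm, star_trivial (√t), Real.mul_self_sqrt ht]
  · rw [norm_smul, Real.norm_of_nonneg ht]
    refine le_trans ?_ hnorm
    gcongr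
    exact CStarAlgebra.norm_le_norm_of_nonneg_of_le hX
      (Finset.sum_le_sum fun i _ => hle i)

end CentralProjections

section NormTowers

variable {B : Type*} [NonUnitalCStarAlgebra B]

/-- A family of endomorphisms satisfying the laws of a global action of `G` on `B`. -/
structure IsGlobalAction (β : G → B →⋆ₙₐ[ℂ] B) : Prop where
  one : ∀ x, β 1 x = x
  mul : ∀ g h x, β (g * h) x = β g (β h x)

namespace IsGlobalAction

variable {H : Type*} [Group H] {β : H → B →⋆ₙₐ[ℂ] B}

theorem apply_inv (hβ : IsGlobalAction β) (g : H) (x : B) : β g (β g⁻¹ x) = x := by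
  rw [← hβ.mul, mul_inv_cancel, hβ.one]

theorem inv_apply (hβ : IsGlobalAction β) (g : H) (x : B) : β g⁻¹ (β g x) = x := by
  rw [← hβ.mul, inv_mul_cancel, hβ.one]

theorem surjective (hβ : IsGlobalAction β) (g : H) : Function.Surjective (β g) :=
  fun x => ⟨_, hβ.apply_inv g x⟩

theorem apply_unit (hβ : IsGlobalAction β) {e : B} (hl : ∀ x, e * x = x)
    (hr : ∀ x, x * e = x) (g : H) : β g e = e := by
  obtain ⟨y, hy⟩ := hβ.surjective g e
  have h := map_mul (β g) e y
  rwa [hl, hy, hr, eq_comm] at h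

end IsGlobalAction

/-- Rokhlin towers inside the corner `p B` of a global action, with all the conditions
expressed in norm. -/
structure IsNormTowers (β : G → B →⋆ₙₐ[ℂ] B) (p : B) (d : ℕ) (c : Prop) (S : Finset B)
    (δ : ℝ) (F : G → Fin (d + 1) → B) : Prop where
  unit_mul : ∀ g j, p * F g j = F g j
  act_unit_mul : ∀ g j, β g p * F g j = F g j
  pos : ∀ g j, IsPosContraction (F g j)
  equivariant : ∀ g h j, ‖β g (F h j) * p - F (g * h) j * β g p‖ < δ
  orthogonal : ∀ g h j, g ≠ h → ‖F g j * F h j‖ < δ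
  sum : ‖∑ j, ∑ g, F g j - p‖ < δ
  central : ∀ g j, ∀ b ∈ S, ‖F g j * b - b * F g j‖ < δ
  commuting : c → ∀ g h j k, ‖F g j * F h k - F h k * F g j‖ < δ

/-- Existence of norm Rokhlin towers for all finite sets and tolerances. -/
def HasNormTowers (β : G → B →⋆ₙₐ[ℂ] B) (p : B) (d : ℕ) (c : Prop) : Prop :=
  ∀ S : Finset B, ∀ δ > 0, ∃ F, IsNormTowers β p d c S δ F

theorem IsPosContraction.map {C : Type*} [NonUnitalCStarAlgebra C] {x : B}
    (hx : IsPosContraction x) (φ : B →⋆ₙₐ[ℂ] C) : IsPosContraction (φ x) := by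
  obtain ⟨⟨b, hb⟩, hn⟩ := hx
  exact ⟨⟨φ b, by rw [hb, map_mul, map_star]⟩, (NonUnitalStarAlgHom.norm_apply_le φ x).trans hn⟩

variable {β : G → B →⋆ₙₐ[ℂ] B} {p e : B} {q : G → B} {d : ℕ} {c : Prop}

theorem norm_mul_le_of_right {x y : B} {δ : ℝ} (hx : ‖x‖ ≤ δ) (hy : ‖y‖ ≤ 1) : ‖x * y‖ ≤ δ :=
  (norm_mul_le x y).trans
    (by simpa using mul_le_mul hx hy (norm_nonneg _) ((norm_nonneg _).trans hx))

theorem norm_mul_le_of_left {x y : B} {δ : ℝ} (hx : ‖x‖ ≤ 1) (hy : ‖y‖ ≤ δ) : ‖x * y‖ ≤ δ :=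
  (norm_mul_le x y).trans
    (by simpa using mul_le_mul hx hy (norm_nonneg _) zero_le_one)

/-- The translates of the base of a tower for the corner form a tower for the global action. -/
theorem HasNormTowers.unit_of_corner (hβ : IsGlobalAction β) (hp : IsCentralProjection p)
    (hl : ∀ x, e * x = x) (hr : ∀ x, x * e = x) (hq : ∀ k, IsCentralProjection (q k))
    (hsum : ∑ k, q k = e) (hle : ∀ k, q k * β k⁻¹ p = q k)
    (h : HasNormTowers β p d c) : HasNormTowers β e d c := by
  classical
  intro S δ hδ
  set n : ℝ := (Fintype.card G : ℝ) with hn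
  have hn0 : 0 ≤ n := Nat.cast_nonneg _
  set K : ℝ := n * ((d + 1) * n + 1) + 4 with hK
  have hK4 : 4 ≤ K := le_add_of_nonneg_left (by positivity)
  set η := δ / K with hη
  have hη0 : 0 < η := div_pos hδ (by linarith)
  have hKη : K * η = δ := mul_div_cancel₀ δ (by linarith)
  have h4η : 4 * η ≤ δ := hKη ▸ mul_le_mul_of_nonneg_right hK4 hη0.le
  obtain ⟨F, hF⟩ := h ((Finset.univ ×ˢ S).image fun x : G × B => β x.1 x.2) η hη0
  have hP : ∀ g, IsCentralProjection (β g p) := fun g => hp.map _ (hβ.surjective g)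
  have hnorm : ∀ g j, ‖F g j‖ ≤ 1 := fun g j => (hF.pos g j).2
  have hmul : ∀ g j, F g j * β g p = F g j := fun g j => by
    rw [← (hP g).comm, hF.act_unit_mul]
  have happrox : ∀ g j, ‖p * β g (F 1 j) - F g j‖ ≤ η := by
    intro g j
    have := hF.equivariant g 1 j
    rw [mul_one, hmul, ← hp.comm] at this
    exact this.le
  have hleft : ∀ g j k, ‖F 1 j * β g (F 1 k) - F 1 j * F g k‖ ≤ η := by
    intro g j k
    have : F 1 j * β g (F 1 k) - F 1 j * F g k = F 1 j * (p * β g (F 1 k) - F g k) := by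
      rw [mul_sub, ← mul_assoc, ← hp.comm, hF.unit_mul]
    rw [this]
    exact norm_mul_le_of_left (hnorm _ _) (happrox g k)
  have hright : ∀ g j k, ‖β g (F 1 k) * F 1 j - F g k * F 1 j‖ ≤ η := by
    intro g j k
    have : β g (F 1 k) * F 1 j - F g k * F 1 j = (p * β g (F 1 k) - F g k) * F 1 j := by
      rw [sub_mul, hp.comm, mul_assoc, hF.unit_mul]
    rw [this]
    exact norm_mul_le_of_right (happrox g k) (hnorm _ _)
  have htrans : ∀ g h x, β h x = β g (β (g⁻¹ * h) x) := by
    intro g h x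
    rw [← hβ.mul, mul_inv_cancel_left]
  refine ⟨fun g j => β g (F 1 j), fun g j => hl _, fun g j => ?_, fun g j => (hF.pos 1 j).map _,
    fun g h j => ?_, fun g h j hgh => ?_, ?_, fun g j b hb => ?_, fun hc g h j k => ?_⟩
  · rw [← map_mul, hl]
  · rw [hr, hβ.apply_unit hl hr, hr, hβ.mul, sub_self, norm_zero]
    exact hδ
  · have hne : (1 : G) ≠ g⁻¹ * h := fun h' => hgh (by simpa using congrArg (g * ·) h')
    rw [htrans g h, ← map_mul]
    have h1 := hleft (g⁻¹ * h) j j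
    have h2 := hF.orthogonal 1 (g⁻¹ * h) j hne
    have h3 := norm_le_insert' (F 1 j * β (g⁻¹ * h) (F 1 j)) (F 1 j * F (g⁻¹ * h) j)
    have h4 := NonUnitalStarAlgHom.norm_apply_le (β g) (F 1 j * β (g⁻¹ * h) (F 1 j))
    linarith
  · set T := ∑ j, ∑ g, β g (F 1 j) with hT
    have hinv : ∀ g, β g T = T := by
      intro g
      simp only [hT, map_sum, ← hβ.mul]
      exact Finset.sum_congr rfl fun j _ => Equiv.sum_comp (Equiv.mulLeft g) fun s => β s (F 1 j)
    have hpT : ‖p * (T - e)‖ ≤ ((d + 1) * n + 1) * η := by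
      have : p * (T - e) = ∑ j, ∑ g, (p * β g (F 1 j) - F g j) + (∑ j, ∑ g, F g j - p) := by
        simp only [hT, mul_sub, hr, Finset.sum_sub_distrib, Finset.mul_sum]
        abel
      rw [this]
      refine (norm_add_le _ _).trans ?_
      have h1 : ‖∑ j, ∑ g, (p * β g (F 1 j) - F g j)‖ ≤ ∑ j : Fin (d + 1), ∑ g : G, η :=
        norm_sum_le_of_le _ fun j _ => norm_sum_le_of_le _ fun g _ => happrox g j
      have h2 := hF.sum
      simp only [Finset.sum_const, Finset.card_univ, Fintype.card_fin, nsmul_eq_mul,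
        Nat.cast_add, Nat.cast_one, ← hn] at h1
      linarith
    have hTe : T - e = ∑ k, q k * β k⁻¹ (p * (T - e)) := by
      have : ∀ k, q k * β k⁻¹ (p * (T - e)) = q k * (T - e) := fun k => by
        rw [map_mul, map_sub, hinv, hβ.apply_unit hl hr, ← mul_assoc, hle]
      simp only [this, ← Finset.sum_mul, hsum, hl]
    have h1 : ‖T - e‖ ≤ ∑ k : G, ((d + 1) * n + 1) * η := by
      rw [hTe]
      exact norm_sum_le_of_le _ fun k _ => norm_mul_le_of_left (hq k).norm_le_one
        ((NonUnitalStarAlgHom.norm_apply_le _ _).trans hpT)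
    rw [Finset.sum_const, Finset.card_univ, nsmul_eq_mul, ← hn] at h1
    have : K * η = n * (((d + 1) * n + 1) * η) + 4 * η := by rw [hK]; ring
    linarith
  · have h1 := hF.central 1 j (β g⁻¹ b)
      (Finset.mem_image.2 ⟨(g⁻¹, b), by simpa using hb, rfl⟩)
    have h2 := NonUnitalStarAlgHom.norm_apply_le (β g) (F 1 j * β g⁻¹ b - β g⁻¹ b * F 1 j)
    rw [map_sub, map_mul, map_mul, hβ.apply_inv] at h2
    linarith
  · rw [htrans g h, ← map_mul, ← map_mul, ← map_sub]
    refine (NonUnitalStarAlgHom.norm_apply_le _ _).trans_lt ?_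
    have h1 := hleft (g⁻¹ * h) j k
    have h2 := hright (g⁻¹ * h) j k
    have h3 := hF.commuting hc 1 (g⁻¹ * h) j k
    have h4 := norm_sub_le_norm_sub_add_norm_sub (F 1 j * β (g⁻¹ * h) (F 1 k))
      (F 1 j * F (g⁻¹ * h) k) (β (g⁻¹ * h) (F 1 k) * F 1 j)
    have h5 := norm_sub_le_norm_sub_add_norm_sub (F 1 j * F (g⁻¹ * h) k)
      (F (g⁻¹ * h) k * F 1 j) (β (g⁻¹ * h) (F 1 k) * F 1 j)
    rw [norm_sub_rev (F (g⁻¹ * h) k * F 1 j)] at h5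
    linarith

/-- Cutting each tower by a fundamental domain contained in the corner and translating the
pieces turns towers for the global action into towers for the corner. -/
theorem HasNormTowers.corner_of_unit (hβ : IsGlobalAction β) (hp : IsCentralProjection p)
    (hl : ∀ x, e * x = x) (hr : ∀ x, x * e = x) (he : IsCentralProjection e)
    (hq : ∀ k, IsCentralProjection (q k)) (horth : ∀ k l, k ≠ l → q k * q l = 0)
    (hsum : ∑ k, q k = e) (hle : ∀ k, q k * β k⁻¹ p = q k)
    (h : HasNormTowers β e d c) : HasNormTowers β p d c := by
  classical
  intro S δ hδ
  obtain ⟨n, hn⟩ : ∃ n : ℝ, n = Fintype.card G := ⟨_, rfl⟩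
  have hn0 : 0 ≤ n := hn ▸ Nat.cast_nonneg _
  set K : ℝ := n * n + n + 3 with hK
  have hK0 : 0 < K := by positivity
  set η := δ / K with hη
  have hη0 : 0 < η := div_pos hδ hK0
  have hKη : n * n * η + n * η + 3 * η = δ := by
    rw [← mul_div_cancel₀ δ hK0.ne', ← hη, hK]; ring
  have hnη : 0 ≤ n * η := by positivity
  have hnnη : 0 ≤ n * n * η := by positivity
  obtain ⟨F, hF⟩ := h S η hη0
  have hequiv : ∀ g h j, ‖β g (F h j) - F (g * h) j‖ ≤ η := by
    intro g h j
    have := hF.equivariant g h j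
    rw [hr, hβ.apply_unit hl hr, hr] at this
    exact this.le
  set t : ℝ := (1 + η)⁻¹ with ht
  have ht0 : 0 ≤ t := by positivity
  have ht1 : t ≤ 1 := inv_le_one_of_one_le₀ (by linarith)
  have htη : t * (1 + η) = 1 := inv_mul_cancel₀ (by positivity)
  have hsmul : ∀ x : B, ‖t • x‖ ≤ ‖x‖ := fun x => by
    rw [norm_smul, Real.norm_of_nonneg ht0]
    exact mul_le_of_le_one_left (norm_nonneg _) ht1
  set r : G → G → B := fun h s => β s (q (h⁻¹ * s)) * p with hrdef
  have hq' : ∀ h s, IsCentralProjection (β s (q (h⁻¹ * s))) :=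
    fun h s => (hq _).map _ (hβ.surjective s)
  have hr' : ∀ h s, IsCentralProjection (r h s) := fun h s => (hq' h s).mul hp
  have hrp : ∀ h s, r h s * p = r h s := fun h s => by
    simp only [hrdef, mul_assoc, hp.idem]
  have hrβ : ∀ h s, r h s * β h p = r h s := by
    intro h s
    have : β h p = β s (β (h⁻¹ * s)⁻¹ p) := by
      rw [← hβ.mul]
      congr 2
      group
    simp only [hrdef]
    rw [hp.mul_right_comm, this, ← map_mul, hle]
  have hrr : ∀ g h s, g ≠ h → r g s * r h s = 0 := by
    intro g h s hgh
    simp only [hrdef]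
    rw [hp.mul_right_comm, ← mul_assoc, ← map_mul, horth _ _ (by simpa using hgh)]
    simp
  have hunit : ∀ z : B, IsCentralProjection z → ∀ h j, (∀ s, r h s * z = r h s) →
      z * (t • ∑ s, F s j * r h s) = t • ∑ s, F s j * r h s := by
    intro z hz h j hrz
    rw [mul_smul_comm, Finset.mul_sum]
    simp only [hz.comm, mul_assoc, hrz]
  have hrn : ∀ g h s s' (x : B), ‖x‖ ≤ η → ‖x * (r g s * r h s')‖ ≤ η := fun g h s s' x hx =>
    norm_mul_le_of_right hx ((hr' g s).mul (hr' h s')).norm_le_one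
  have hmulF : ∀ g h s s' j k,
      (F s j * r g s) * (F s' k * r h s') = F s j * F s' k * (r g s * r h s') := by
    intro g h s s' j k
    rw [← mul_assoc, (hr' g s).mul_right_comm, mul_assoc, mul_assoc, mul_assoc]
  have hdouble : ∀ x : G → G → B, (∀ s s', ‖x s s'‖ ≤ η) →
      ‖∑ s, ∑ s', x s s'‖ ≤ n * n * η := by
    intro x hx
    have h1 : ‖∑ s, ∑ s', x s s'‖ ≤ ∑ s : G, ∑ s' : G, η :=
      norm_sum_le_of_le _ fun s _ => norm_sum_le_of_le _ fun s' _ => hx s s'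
    simpa [← hn, mul_assoc] using h1
  have hsingle : ∀ x : G → B, (∀ s, ‖x s‖ ≤ η) → ‖∑ s, x s‖ ≤ n * η := by
    intro x hx
    have h1 : ‖∑ s, x s‖ ≤ ∑ s : G, η := norm_sum_le_of_le _ fun s _ => hx s
    simpa [← hn] using h1
  refine ⟨fun h j => t • ∑ s, F s j * r h s, fun h j => hunit p hp h j (hrp h),
    fun h j => hunit _ (hp.map _ (hβ.surjective h)) h j (hrβ h), fun h j => ?_,
    fun g h j => ?_, fun g h j hgh => ?_, ?_, fun g j b hb => ?_, fun hc g h j k => ?_⟩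
  · have hX : t * ‖∑ x : Fin (d + 1) × G, F x.2 x.1‖ ≤ 1 := by
      rw [← htη]
      gcongr
      rw [Fintype.sum_prod_type]
      have h1 := hF.sum
      have h2 := he.norm_le_one
      have h3 := norm_le_insert' (∑ j, ∑ g, F g j) e
      linarith
    have := isPosContraction_smul_sum (fun x : Fin (d + 1) × G => F x.2 x.1)
      (fun x => if x.1 = j then r h x.2 else 0) (fun x => (hF.pos x.2 x.1).1)
      (fun x => by
        by_cases hx : x.1 = j
        · simpa [hx] using hr' h x.2
        · simpa [hx] using IsCentralProjection.zero) ht0 hX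
    rw [Fintype.sum_prod_type, Finset.sum_eq_single j (by simp +contextual) (by simp)] at this
    simpa using this
  · have : β g (t • ∑ s, F s j * r h s) * p - (t • ∑ s, F s j * r (g * h) s) * β g p
        = t • ∑ s, (β g (F s j) - F (g * s) j) *
            (β (g * s) (q (h⁻¹ * s)) * p * β g p) := by
      rw [← Equiv.sum_comp (Equiv.mulLeft g) fun s => F s j * r (g * h) s]
      have hmap : β g (t • ∑ s, F s j * r h s) = t • ∑ s, β g (F s j) * β g (r h s) := by
        have : ∀ x, β g (t • x) = t • β g x := fun x => by
          rw [← Complex.coe_smul, map_smul, Complex.coe_smul]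
        simp only [this, map_sum, map_mul]
      rw [hmap, smul_mul_assoc, smul_mul_assoc, ← smul_sub, Finset.sum_mul, Finset.sum_mul,
        ← Finset.sum_sub_distrib]
      congr 1
      refine Finset.sum_congr rfl fun s _ => ?_
      have hs : (g * h)⁻¹ * (g * s) = h⁻¹ * s := by group
      simp only [hrdef, Equiv.coe_mulLeft, hs, map_mul, sub_mul, hβ.mul, mul_assoc]
      rw [hp.comm (β g p)]
    rw [this]
    refine (hsmul _).trans_lt ((hsingle _ fun s => ?_).trans_lt (by linarith))
    exact norm_mul_le_of_right (hequiv _ _ _)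
      ((((hq _).map _ (hβ.surjective _)).mul hp).mul
        (hp.map _ (hβ.surjective g))).norm_le_one
  · rw [smul_mul_assoc, mul_smul_comm]
    refine (hsmul _).trans_lt ((hsmul _).trans_lt ?_)
    rw [Finset.sum_mul_sum]
    simp only [hmulF]
    refine (hdouble _ fun s s' => ?_).trans_lt (by linarith)
    by_cases hs : s = s'
    · subst hs
      rw [hrr g h s hgh]
      simpa using hη0.le
    · exact hrn _ _ _ _ _ (hF.orthogonal s s' j hs).le
  · have hcol : ∀ s, ∑ h, r h s = p := by
      intro s
      have : ∑ h, q (h⁻¹ * s) = e := by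
        rw [← hsum]
        exact Equiv.sum_comp ((Equiv.inv G).trans (Equiv.mulRight s)) q
      simp only [hrdef]
      rw [← Finset.sum_mul, ← map_sum, this, hβ.apply_unit hl hr, hl]
    have htotal : ∑ j, ∑ h, t • ∑ s, F s j * r h s = t • ((∑ j, ∑ s, F s j) * p) := by
      simp only [← Finset.smul_sum, Finset.sum_mul]
      congr 1
      refine Finset.sum_congr rfl fun j _ => ?_
      rw [Finset.sum_comm]
      simp only [← Finset.mul_sum, hcol]
    have : ∑ j, ∑ h, t • ∑ s, F s j * r h s - p
        = t • ((∑ j, ∑ s, F s j - e) * p) - (1 - t) • p := by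
      rw [htotal, sub_mul, hl, smul_sub, sub_smul, one_smul]
      abel
    rw [this]
    have h1 := (hsmul ((∑ j, ∑ s, F s j - e) * p)).trans (hp.norm_mul_le _)
    have h2 : ‖(1 - t) • p‖ ≤ η := by
      rw [norm_smul, Real.norm_of_nonneg (by linarith)]
      have h3 := mul_le_of_le_one_right (sub_nonneg.2 ht1) hp.norm_le_one
      have h4 : t * η ≤ 1 * η := mul_le_mul_of_nonneg_right ht1 hη0.le
      linarith
    have h3 := norm_sub_le (t • ((∑ j, ∑ s, F s j - e) * p)) ((1 - t) • p)
    have h4 := hF.sum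
    linarith
  · rw [smul_mul_assoc, mul_smul_comm, ← smul_sub, Finset.sum_mul, Finset.mul_sum,
      ← Finset.sum_sub_distrib]
    refine (hsmul _).trans_lt ((hsingle _ fun s => ?_).trans_lt (by linarith))
    rw [(hr' g s).mul_right_comm, ← mul_assoc b, ← sub_mul]
    exact ((hr' g s).norm_mul_le _).trans (hF.central s j b hb).le
  · rw [smul_mul_assoc, smul_mul_assoc, mul_smul_comm, mul_smul_comm, ← smul_sub, ← smul_sub]
    refine (hsmul _).trans_lt ((hsmul _).trans_lt ?_)
    rw [Finset.sum_mul_sum, Finset.sum_mul_sum, Finset.sum_comm (s := Finset.univ (α := G))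
      (f := fun s s' => F s k * r h s * (F s' j * r g s'))]
    simp only [← Finset.sum_sub_distrib, hmulF]
    refine (hdouble _ fun s s' => ?_).trans_lt (by linarith)
    rw [(hr' h s').comm, ← sub_mul]
    exact hrn _ _ _ _ _ (hF.commuting hc s s' j k).le

end NormTowers

section Transfer

variable {B : Type*} [NonUnitalCStarAlgebra B]

/-- A C*-algebra with unit `u`, embedded equivariantly as an ideal of a global action so that the
partial action is the restriction of the global one. -/
structure IsRestriction (α : CStarPartialAction G A) (β : G → B →⋆ₙₐ[ℂ] B) (ι : A →⋆ₙₐ[ℂ] B)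
    (u : A) : Prop where
  unit_mul : ∀ x, u * x = x
  mul_unit : ∀ x, x * u = x
  injective : Function.Injective ι
  ideal_left : ∀ b a, b * ι a ∈ Set.range ι
  ideal_right : ∀ b a, ι a * b ∈ Set.range ι
  dom : ∀ g, ι '' α.dom g = Set.range ι ∩ β g '' Set.range ι
  act : ∀ g, ∀ x ∈ α.dom g⁻¹, ι (α.act g x) = β g (ι x)

namespace IsRestriction

section

variable {H : Type*} [Group H] {α : CStarPartialAction H A} {β : H → B →⋆ₙₐ[ℂ] B}
  {ι : A →⋆ₙₐ[ℂ] B} {u : A}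

theorem isCentralProjection (h : IsRestriction α β ι u) : IsCentralProjection (ι u) where
  idem := by rw [← map_mul, h.unit_mul]
  star_eq := by
    rw [← map_star, ← h.unit_mul (star u), ← star_star (u * star u), star_mul, star_star,
      h.unit_mul, star_star]
  comm b := by
    obtain ⟨x, hx⟩ := h.ideal_left b u
    obtain ⟨y, hy⟩ := h.ideal_right b u
    have h1 : ι u * (b * ι u) = b * ι u := by rw [← hx, ← map_mul, h.unit_mul]
    have h2 : ι u * b * ι u = ι u * b := by rw [← hy, ← map_mul, h.mul_unit]
    rw [← h2, mul_assoc, h1]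

theorem mem_range_iff (h : IsRestriction α β ι u) {b : B} :
    b ∈ Set.range ι ↔ ι u * b = b := by
  constructor
  · rintro ⟨a, rfl⟩
    rw [← map_mul, h.unit_mul]
  · intro hb
    rw [← hb]
    exact h.ideal_right b u

theorem mem_dom_iff (h : IsRestriction α β ι u) (hβ : IsGlobalAction β) {g : H} {x : A} :
    x ∈ α.dom g ↔ β g (ι u) * ι x = ι x := by
  rw [← h.injective.mem_set_image, h.dom]
  constructor
  · rintro ⟨-, _, ⟨y, rfl⟩, hy⟩
    rw [← hy, ← map_mul, ← map_mul, h.unit_mul]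
  · intro hx
    refine ⟨⟨x, rfl⟩, β g⁻¹ (ι x), h.mem_range_iff.2 ?_, hβ.apply_inv g _⟩
    have := congrArg (β g⁻¹) hx
    rwa [map_mul, hβ.inv_apply] at this

theorem norm_map (h : IsRestriction α β ι u) (x : A) : ‖ι x‖ = ‖x‖ :=
  NonUnitalStarAlgHom.norm_map ι h.injective x

theorem isPosContraction_of_map (h : IsRestriction α β ι u) {x : A}
    (hx : IsPosContraction (ι x)) : IsPosContraction x := by
  obtain ⟨⟨b, hb⟩, hn⟩ := hx
  have hp := h.isCentralProjection
  obtain ⟨y, hy⟩ := h.ideal_left b u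
  refine ⟨⟨y, h.injective ?_⟩, h.norm_map x ▸ hn⟩
  rw [map_mul, map_star, hy, star_mul, hp.star_eq, hp.comm, ← mul_assoc, hp.mul_right_comm,
    ← hb, mul_assoc, hp.idem, ← map_mul, h.mul_unit]

end

variable {α : CStarPartialAction G A} {β : G → B →⋆ₙₐ[ℂ] B} {ι : A →⋆ₙₐ[ℂ] B} {u : A}
  {d : ℕ} {c : Prop}

theorem hasNormTowers_of_towers (h : IsRestriction α β ι u) (hβ : IsGlobalAction β)
    (hα : ∀ ε > (0 : ℝ), ∀ S : Finset A, ∃ f : G → Fin (d + 1) → A,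
      RokhlinTowers α d S ε f ∧ (c → CommutingTowers d S ε f)) :
    HasNormTowers β (ι u) d c := by
  classical
  intro S δ hδ
  have hp := h.isCentralProjection
  choose π hπ using fun b => h.ideal_right b u
  obtain ⟨f, ⟨hf, hequiv, horth, hsum, hcent⟩, hcomm⟩ := hα δ hδ
    (insert u ((S ∪ Finset.univ.image fun g => β g (ι u)).image π))
  have hu : u ∈ insert u ((S ∪ Finset.univ.image fun g => β g (ι u)).image π) :=
    Finset.mem_insert_self _ _
  have hπmem : ∀ b ∈ S ∪ Finset.univ.image fun g => β g (ι u),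
      π b ∈ insert u ((S ∪ Finset.univ.image fun g => β g (ι u)).image π) := fun b hb =>
    Finset.mem_insert_of_mem (Finset.mem_image_of_mem π hb)
  have hfu : ∀ g j, ι (f g j) * ι u = ι (f g j) := fun g j => by rw [← map_mul, h.mul_unit]
  have huf : ∀ g j, ι u * ι (f g j) = ι (f g j) := fun g j => by rw [← map_mul, h.unit_mul]
  refine ⟨fun g j => ι (f g j), huf, fun g j => (h.mem_dom_iff hβ).1 (hf g j).1,
    fun g j => (hf g j).2.map ι, fun g h' j => ?_, fun g h' j hg => ?_, ?_,
    fun g j b hb => ?_, fun hc g h' j k => ?_⟩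
  · have hmem : π (β g⁻¹ (ι u)) ∈ α.dom g⁻¹ := by
      rw [h.mem_dom_iff hβ, hπ, hp.comm, ← mul_assoc, ← map_mul, hp.idem]
    have hmem' : f h' j * π (β g⁻¹ (ι u)) ∈ α.dom g⁻¹ := α.mul_mem_left _ _ _ hmem
    have := hequiv g h' j u hu (π (β g⁻¹ (ι u)))
      (hπmem _ (Finset.mem_union_right _ (Finset.mem_image_of_mem _ (Finset.mem_univ _)))) hmem
    rw [h.mul_unit, ← h.norm_map, map_sub, map_mul, h.act _ _ hmem, h.act _ _ hmem',
      map_mul, hπ, ← mul_assoc, hfu, map_mul, map_mul, hβ.apply_inv, ← hp.comm (β g (ι u)),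
      ← mul_assoc, hfu] at this
    exact this
  · have := horth j g h' hg u hu
    rwa [h.mul_unit, ← h.norm_map, map_mul] at this
  · have := hsum u hu
    rw [h.mul_unit, ← h.norm_map, map_sub] at this
    simpa only [map_sum] using this
  · have := hcent g j u hu (π b) (hπmem _ (Finset.mem_union_left _ hb))
    rwa [h.mul_unit, ← h.norm_map, map_sub, map_mul, map_mul, hπ, ← mul_assoc, hfu, hp.comm b,
      mul_assoc, huf] at this
  · have := hcomm hc g h' j k u hu
    rwa [h.mul_unit, ← h.norm_map, map_sub, map_mul, map_mul] at this

theorem towers_of_hasNormTowers (h : IsRestriction α β ι u) (hβ : IsGlobalAction β)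
    (hβp : HasNormTowers β (ι u) d c) (ε : ℝ) (hε : 0 < ε) (S : Finset A) :
    ∃ f : G → Fin (d + 1) → A, RokhlinTowers α d S ε f ∧ (c → CommutingTowers d S ε f) := by
  classical
  have hp := h.isCentralProjection
  set C : ℝ := 1 + ∑ a ∈ S, ‖a‖ with hC
  have hC1 : 1 ≤ C := le_add_of_nonneg_right (Finset.sum_nonneg fun _ _ => norm_nonneg _)
  have hSC : ∀ a ∈ S, ‖a‖ ≤ C := fun a ha =>
    (Finset.single_le_sum (f := fun a => ‖a‖) (fun _ _ => norm_nonneg _) ha).trans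
      (le_add_of_nonneg_left zero_le_one)
  have hδ : 0 < ε / (C * C) := by positivity
  have hδε : ε / (C * C) * (C * C) = ε := div_mul_cancel₀ _ (by positivity)
  have hbound₂ : ∀ x y a : B, ‖x‖ < ε / (C * C) → ‖y‖ ≤ C → ‖a‖ ≤ C → ‖x * y * a‖ < ε := by
    intro x y a hx hy ha
    calc ‖x * y * a‖ ≤ ‖x‖ * ‖y‖ * ‖a‖ := norm_mul₃_le
      _ ≤ ‖x‖ * (C * C) := by rw [mul_assoc]; gcongr
      _ < ε / (C * C) * (C * C) := by gcongr
      _ = ε := hδε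
  have hbound₁ : ∀ x a : B, ‖x‖ < ε / (C * C) → ‖a‖ ≤ C → ‖x * a‖ < ε := by
    intro x a hx ha
    calc ‖x * a‖ ≤ ‖x‖ * ‖a‖ := norm_mul_le _ _
      _ ≤ ‖x‖ * (C * C) := by gcongr; nlinarith
      _ < ε / (C * C) * (C * C) := by gcongr
      _ = ε := hδε
  obtain ⟨F, hF⟩ := hβp (S.image ι) _ hδ
  choose f hf using fun g j => h.mem_range_iff.2 (hF.unit_mul g j)
  have hSC' : ∀ a ∈ S, ‖ι a‖ ≤ C := fun a ha => (h.norm_map a).trans_le (hSC a ha)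
  refine ⟨f, ⟨fun g j => ⟨?_, ?_⟩, fun g h' j a ha x hx hxg => ?_, fun j g h' hg a ha => ?_,
    fun a ha => ?_, fun g j a ha b hb => ?_⟩, fun hc g h' j k a ha => ?_⟩
  · rw [h.mem_dom_iff hβ, hf, hF.act_unit_mul]
  · exact h.isPosContraction_of_map (hf g j ▸ hF.pos g j)
  · have hx' : f h' j * x ∈ α.dom g⁻¹ := α.mul_mem_left _ _ _ hxg
    have hxp : ι u * β g (ι x) = β g (ι x) := by
      rw [← h.act _ _ hxg, ← map_mul, h.unit_mul]
    have hxg' : β g (ι u) * β g (ι x) = β g (ι x) := by rw [← map_mul, ← map_mul, h.unit_mul]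
    have : ι ((α.act g (f h' j * x) - f (g * h') j * α.act g x) * a)
        = (β g (F h' j) * ι u - F (g * h') j * β g (ι u)) * β g (ι x) * ι a := by
      rw [map_mul, map_sub, h.act _ _ hx', map_mul, map_mul, map_mul, h.act _ _ hxg, hf, hf,
        sub_mul (β g (F h' j) * ι u), mul_assoc (β g (F h' j)), hxp, mul_assoc (F (g * h') j),
        hxg']
    rw [← h.norm_map, this]
    exact hbound₂ _ _ _ (hF.equivariant g h' j)
      ((NonUnitalStarAlgHom.norm_apply_le _ _).trans (hSC' x hx)) (hSC' a ha)
  · rw [← h.norm_map, map_mul, map_mul, hf, hf]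
    exact hbound₁ _ _ (hF.orthogonal g h' j hg) (hSC' a ha)
  · have : ι ((∑ j, ∑ g, f g j) * a - a) = (∑ j, ∑ g, F g j - ι u) * ι a := by
      rw [sub_mul, ← map_mul ι u, h.unit_mul, map_sub, map_mul]
      simp only [map_sum, hf]
    rw [← h.norm_map, this]
    exact hbound₁ _ _ hF.sum (hSC' a ha)
  · rw [← h.norm_map, map_mul, map_sub, map_mul, map_mul, hf]
    exact hbound₁ _ _ (hF.central g j _ (Finset.mem_image_of_mem ι hb)) (hSC' a ha)
  · rw [← h.norm_map, map_mul, map_sub, map_mul, map_mul, hf, hf]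
    exact hbound₁ _ _ (hF.commuting hc g h' j k) (hSC' a ha)

theorem hasRokhlinDimLE_iff (h : IsRestriction α β ι u) (hβ : IsGlobalAction β) :
    HasRokhlinDimLE α d ↔ HasNormTowers β (ι u) d False := by
  constructor
  · intro hα
    exact h.hasNormTowers_of_towers hβ fun ε hε S =>
      (hα ε hε S).imp fun f hf => ⟨hf, False.elim⟩
  · intro hβp ε hε S
    exact (h.towers_of_hasNormTowers hβ hβp ε hε S).imp fun f hf => hf.1

theorem hasRokhlinDimCLE_iff (h : IsRestriction α β ι u) (hβ : IsGlobalAction β) :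
    HasRokhlinDimCLE α d ↔ HasNormTowers β (ι u) d True := by
  constructor
  · intro hα
    exact h.hasNormTowers_of_towers hβ fun ε hε S =>
      (hα ε hε S).imp fun f hf => ⟨hf.1, fun _ => hf.2⟩
  · intro hβp ε hε S
    exact (h.towers_of_hasNormTowers hβ hβp ε hε S).imp fun f hf => ⟨hf.1, hf.2 trivial⟩

end IsRestriction

/-- A partial action all of whose domains are the whole algebra, as a family of
*-homomorphisms. -/
def CStarPartialAction.toStarAlgHom (γ : CStarPartialAction G B)
    (hγ : ∀ g, γ.dom g = Set.univ) (g : G) : B →⋆ₙₐ[ℂ] B where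
  toFun := γ.act g
  map_smul' c x := γ.act_smul g c x (by simp [hγ])
  map_zero' := by simpa using γ.act_smul g 0 0 (by simp [hγ])
  map_add' x y := γ.act_add g x (by simp [hγ]) y (by simp [hγ])
  map_mul' x y := γ.act_mul g x (by simp [hγ]) y (by simp [hγ])
  map_star' x := γ.act_star g x (by simp [hγ])

theorem CStarPartialAction.isGlobalAction_toStarAlgHom {H : Type*} [Group H]
    (γ : CStarPartialAction H B)
    (hγ : ∀ g, γ.dom g = Set.univ) : IsGlobalAction (γ.toStarAlgHom hγ) where
  one := γ.act_one
  mul g h x := γ.act_comp g h x (by simp [hγ])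

/-- If the translates of a corner span a dense subspace, then the algebra has a unit which is
an orthogonal sum of central projections dominated by translates of the unit of the corner. -/
theorem exists_unit_partition {β : G → B →⋆ₙₐ[ℂ] B} (hβ : IsGlobalAction β) {p : B}
    (hp : IsCentralProjection p) {R : Set B} (hR : ∀ x ∈ R, p * x = x)
    (hspan : Dense (Submodule.span ℂ (⋃ g, β g '' R) : Set B)) :
    ∃ (e : B) (q : G → B), (∀ x, e * x = x) ∧ IsCentralProjection e ∧
      (∀ k, IsCentralProjection (q k)) ∧ (∀ k l, k ≠ l → q k * q l = 0) ∧
      (∑ k, q k = e) ∧ ∀ k, q k * β k⁻¹ p = q k := by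
  classical
  obtain ⟨q, hq, horth, hle, -, he, hcover⟩ := exists_orthogonal_centralProjections
    (fun k => β k⁻¹ p) (fun k => hp.map _ (hβ.surjective _)) Finset.univ
  refine ⟨_, q, fun x => ?_, he, hq, horth, rfl, hle⟩
  set e := ∑ k, q k
  have hclosed : IsClosed {x : B | e * x = x} :=
    isClosed_eq (continuous_const.mul continuous_id) continuous_id
  have hsub : (Submodule.span ℂ (⋃ g, β g '' R) : Set B) ⊆ {x : B | e * x = x} := by
    intro x hx
    induction hx using Submodule.span_induction with
    | mem x hx =>
      obtain ⟨g, y, hy, rfl⟩ := Set.mem_iUnion.1 hx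
      have h := hcover g⁻¹ (Finset.mem_univ _)
      rw [inv_inv] at h
      change e * β g y = β g y
      rw [← hR y hy, map_mul, ← mul_assoc, h]
    | zero => simp
    | add x y _ _ hx hy =>
      change e * (x + y) = x + y
      rw [mul_add, show e * x = x from hx, show e * y = y from hy]
    | smul a x _ hx =>
      change e * (a • x) = a • x
      rw [mul_smul_comm, show e * x = x from hx]
  exact hclosed.closure_subset_iff.2 hsub (hspan x)

end Transfer

/-- If `α` is a globalizable partial action of a finite group `G` on a
*unital* C*-algebra `A`, with globalization `(B, β)` (here `β` is encoded as the partial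
action `βp` on `B` all of whose domains are `B`, i.e. a global action, and `ι : A → B` is
the equivariant embedding of the globalization), then `dim_Rok(α) = dim_Rok(β)` and
`dim_Rok^c(α) = dim_Rok^c(β)`. -/
theorem rokhlinDim_eq_of_globalization {G : Type*} [Group G] [Fintype G]
    {A : Type*} [CStarAlgebra A] {B : Type*} [NonUnitalCStarAlgebra B]
    (α : CStarPartialAction G A) (βp : CStarPartialAction G B)
    (hβglobal : ∀ g, βp.dom g = Set.univ)
    (ι : A → B)
    (hιadd : ∀ x y, ι (x + y) = ι x + ι y)
    (hιsmul : ∀ (c : ℂ) x, ι (c • x) = c • ι x)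
    (hιmul : ∀ x y, ι (x * y) = ι x * ι y)
    (hιstar : ∀ x, ι (star x) = star (ι x))
    (hιinj : Function.Injective ι)
    (hιclosed : IsClosed (Set.range ι))
    (hιideal : ∀ (b : B), ∀ a ∈ Set.range ι, b * a ∈ Set.range ι ∧ a * b ∈ Set.range ι)
    (hdom : ∀ g, ι '' α.dom g = Set.range ι ∩ βp.act g '' Set.range ι)
    (hact : ∀ g, ∀ x ∈ α.dom g⁻¹, ι (α.act g x) = βp.act g (ι x))
    (hspan : Dense (Submodule.span ℂ (⋃ g : G, βp.act g '' Set.range ι) : Set B)) :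
    rokhlinDim α = rokhlinDim βp ∧ rokhlinDimC α = rokhlinDimC βp := by
  classical
  set β := βp.toStarAlgHom hβglobal
  have hβ : IsGlobalAction β := βp.isGlobalAction_toStarAlgHom hβglobal
  let φ : A →⋆ₙₐ[ℂ] B :=
    { toFun := ι
      map_smul' := hιsmul
      map_zero' := by simpa using hιsmul 0 0
      map_add' := hιadd
      map_mul' := hιmul
      map_star' := hιstar }
  have hα : IsRestriction α β φ 1 :=
    ⟨one_mul, mul_one, hιinj, fun b a => (hιideal b (ι a) ⟨a, rfl⟩).1,
      fun b a => (hιideal b (ι a) ⟨a, rfl⟩).2, hdom, hact⟩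
  have hp := hα.isCentralProjection
  obtain ⟨e, q, hl, he, hq, horth, hsum, hle⟩ := exists_unit_partition hβ hp
    (fun x hx => hα.mem_range_iff.1 hx) hspan
  have hr : ∀ x, x * e = x := fun x => by rw [← he.comm, hl]
  have hid : IsRestriction βp β (NonUnitalStarAlgHom.id ℂ B) e :=
    ⟨hl, hr, Function.injective_id, fun b a => ⟨b * a, rfl⟩, fun b a => ⟨a * b, rfl⟩,
      fun g => by simp [hβglobal, (hβ.surjective g).range_eq], fun g x _ => rfl⟩
  have key : ∀ d c, HasNormTowers β (φ 1) d c ↔ HasNormTowers β e d c := fun d c =>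
    ⟨fun h => h.unit_of_corner hβ hp hl hr hq hsum hle,
      fun h => h.corner_of_unit hβ hp hl hr he hq horth hsum hle⟩
  have hdim : ∀ d, HasRokhlinDimLE α d ↔ HasRokhlinDimLE βp d := fun d =>
    (hα.hasRokhlinDimLE_iff hβ).trans ((key d _).trans (hid.hasRokhlinDimLE_iff hβ).symm)
  have hdimC : ∀ d, HasRokhlinDimCLE α d ↔ HasRokhlinDimCLE βp d := fun d =>
    (hα.hasRokhlinDimCLE_iff hβ).trans ((key d _).trans (hid.hasRokhlinDimCLE_iff hβ).symm)
  simp only [rokhlinDim, rokhlinDimC, hdim, hdimC, and_self]
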